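/- arXiv:1707.02532 — 3 statements merged into one kernel-verified Lean document; each statement's English description precedes it below -/
import Mathlib

section
/- Let X be a real Hilbert space, φ : X → ℝ of class C², h ∈ ℝ and ε > 0. Assume ‖φ′(u)‖ ≥ 2ε for every u ∈ φ⁻¹([h−2ε, h+2ε]), and let D be any subset of X with D ⊆ φ⁻¹([h−ε/3, h+ε/3]). Then there exists a continuous map η : X → X such that: (i) η(u) = u for every u ∉ φ⁻¹([h−2ε, h+2ε]) \ D; (ii) η(φ⁻¹([h−ε, h−ε/2])) ⊆ φ⁻¹([h+ε, h+(3/2)ε]); (iii) η(φ⁻¹([h+ε/2, h+ε])) ⊆ φ⁻¹([h−(3/2)ε, h−ε]). -/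
open Set Metric Filter Topology

theorem IsIntegralCurveOn.eqOn_Icc {E : Type*} [NormedAddCommGroup E] [NormedSpace ℝ E]
    {V : E → E} (hV : ContDiff ℝ 1 V) {f g : ℝ → E} {T : ℝ}
    (hf : IsIntegralCurveOn f (fun _ ↦ V) (Icc 0 T))
    (hg : IsIntegralCurveOn g (fun _ ↦ V) (Icc 0 T)) (h0 : f 0 = g 0) :
    EqOn f g (Icc 0 T) := by
  have hfc := hf.continuousOn
  have hgc := hg.continuousOn
  have hclosed : IsClosed ({t | f t = g t} ∩ Icc 0 T) := by
    have := (hfc.prodMk hgc).preimage_isClosed_of_isClosed isClosed_Icc isClosed_diagonal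
    rwa [inter_comm] at this
  refine hclosed.Icc_subset_of_forall_mem_nhdsWithin h0 ?_
  rintro t ⟨htfg, ht⟩
  obtain ⟨K, N, hN, hK⟩ := hV.contDiffAt (x := f t) |>.exists_lipschitzOnWith
  have hle : 𝓝[≥] t ≤ 𝓝[Icc 0 T] t := nhdsWithin_le_iff.2 (Icc_mem_nhdsGE_of_mem ht)
  have hfN : ∀ᶠ s in 𝓝[≥] t, f s ∈ N :=
    ((hfc t (Ico_subset_Icc_self ht)).mono_left hle) hN
  have hgN : ∀ᶠ s in 𝓝[≥] t, g s ∈ N :=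
    ((hgc t (Ico_subset_Icc_self ht)).mono_left hle) (by rwa [← htfg])
  obtain ⟨b, hb, hbN⟩ := (mem_nhdsGE_iff_exists_mem_Ioc_Ico_subset ht.2).1 (hfN.and hgN)
  have hsub : Icc t b ⊆ Icc 0 T := Icc_subset_Icc ht.1 hb.2
  have hderiv : ∀ {k : ℝ → E}, IsIntegralCurveOn k (fun _ ↦ V) (Icc 0 T) →
      ∀ s ∈ Ico t b, HasDerivWithinAt k (V (k s)) (Ici s) s := fun hk s hs ↦
    (hk s (hsub (Ico_subset_Icc_self hs))).mono_of_mem_nhdsWithin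
      (Icc_mem_nhdsGE_of_mem ⟨ht.1.trans hs.1, hs.2.trans_le hb.2⟩)
  have heq : EqOn f g (Icc t b) :=
    ODE_solution_unique_of_mem_Icc_right (v := fun _ ↦ V) (s := fun _ ↦ N) (fun _ _ ↦ hK)
      (hfc.mono hsub) (hderiv hf) (fun s hs ↦ (hbN hs).1)
      (hgc.mono hsub) (hderiv hg) (fun s hs ↦ (hbN hs).2) htfg
  exact mem_of_superset (Icc_mem_nhdsGT hb.1) heq

/-- Integral curves of `V` starting near `x` exist on `[0, t]` and depend continuously on the
starting point. -/
def HasLocalFlow {E : Type*} [NormedAddCommGroup E] [NormedSpace ℝ E]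
    (V : E → E) (x : E) (t : ℝ) : Prop :=
  ∃ U ∈ 𝓝 x, ∃ α : E → ℝ → E,
    (∀ y ∈ U, α y 0 = y ∧ IsIntegralCurveOn (α y) (fun _ ↦ V) (Icc 0 t)) ∧
    ContinuousOn (fun q : E × ℝ ↦ α q.1 q.2) (U ×ˢ Icc 0 t)

namespace HasLocalFlow

variable {E : Type*} [NormedAddCommGroup E] [NormedSpace ℝ E] {V : E → E}

theorem mono {x : E} {s t : ℝ} (h : HasLocalFlow V x t) (hst : s ≤ t) :
    HasLocalFlow V x s := by
  obtain ⟨U, hU, α, hα, hc⟩ := h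
  have hsub : Icc 0 s ⊆ Icc 0 t := Icc_subset_Icc_right hst
  exact ⟨U, hU, α, fun y hy ↦ ⟨(hα y hy).1, (hα y hy).2.mono hsub⟩,
    hc.mono (prod_mono_right hsub)⟩

theorem eventually_of_contDiff [CompleteSpace E] (hV : ContDiff ℝ 1 V) (p : E) :
    ∃ δ > 0, ∀ᶠ q in 𝓝 p, HasLocalFlow V q δ := by
  obtain ⟨δ, hδ, a, r, L, K, hr, hPL⟩ :=
    IsPicardLindelof.of_contDiffAt_one (hV.contDiffAt (x := p))
  obtain ⟨α, hα, hc⟩ := (hPL 0).exists_forall_mem_closedBall_eq_hasDerivWithinAt_continuousOn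
  have hsub : Icc 0 δ ⊆ Icc (0 - δ) (0 + δ) := Icc_subset_Icc (by linarith) (by linarith)
  refine ⟨δ, hδ, ?_⟩
  filter_upwards [ball_mem_nhds p (NNReal.coe_pos.2 hr)] with q hq
  refine ⟨closedBall p r, mem_of_superset (isOpen_ball.mem_nhds hq) ball_subset_closedBall,
    fun y t ↦ α (y, t), fun y hy ↦ ⟨(hα y hy).1, ?_⟩, hc.mono (prod_mono_right hsub)⟩
  intro t ht
  exact ((hα y hy).2 t (hsub ht)).mono hsub

end HasLocalFlow

/-- Integral curves of an autonomous vector field on consecutive intervals can be concatenated. -/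
theorem IsIntegralCurveOn.concat {E : Type*} [NormedAddCommGroup E] [NormedSpace ℝ E]
    {V : E → E} {f g : ℝ → E} {t δ : ℝ} (ht : 0 ≤ t) (hδ : 0 ≤ δ)
    (hf : IsIntegralCurveOn f (fun _ ↦ V) (Icc 0 t))
    (hg : IsIntegralCurveOn g (fun _ ↦ V) (Icc 0 δ)) (hfg : g 0 = f t) :
    IsIntegralCurveOn (fun s ↦ f (min s t) + (g (max (s - t) 0) - f t)) (fun _ ↦ V)
      (Icc 0 (t + δ)) := by
  set k : ℝ → E := fun s ↦ f (min s t) + (g (max (s - t) 0) - f t)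
  have hkf : EqOn k f (Icc 0 t) := fun s hs ↦ by
    simp [k, min_eq_left hs.2, max_eq_right (sub_nonpos.2 hs.2), hfg]
  have hkg : EqOn k (fun s ↦ g (s - t)) (Icc t (t + δ)) := fun s hs ↦ by
    simp [k, min_eq_right hs.1, max_eq_left (sub_nonneg.2 hs.1)]
  have hunion : Icc 0 (t + δ) = Icc 0 t ∪ Icc t (t + δ) :=
    (Icc_union_Icc_eq_Icc ht (by linarith)).symm
  intro s hs
  rw [hunion]
  refine HasDerivWithinAt.union ?_ ?_
  · by_cases hst : s ≤ t
    · have hs' : s ∈ Icc 0 t := ⟨hs.1, hst⟩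
      simpa only [hkf hs'] using (hf s hs').congr hkf (hkf hs')
    · refine HasFDerivWithinAt.of_notMem_closure ?_
      rw [closure_Icc]
      exact fun h ↦ hst h.2
  · by_cases hst : t ≤ s
    · have hs' : s ∈ Icc t (t + δ) := ⟨hst, hs.2⟩
      have hmaps : MapsTo (fun r ↦ r - t) (Icc t (t + δ)) (Icc 0 δ) :=
        fun r hr ↦ ⟨sub_nonneg.2 hr.1, sub_le_iff_le_add'.2 hr.2⟩
      have hg' := (hg (s - t) (hmaps hs')).scomp s
        ((hasDerivWithinAt_id s (Icc t (t + δ))).sub_const t) hmaps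
      rw [one_smul] at hg'
      simpa only [hkg hs'] using hg'.congr hkg (hkg hs')
    · refine HasFDerivWithinAt.of_notMem_closure ?_
      rw [closure_Icc]
      exact fun h ↦ hst h.1

namespace HasLocalFlow

variable {E : Type*} [NormedAddCommGroup E] [NormedSpace ℝ E] {V : E → E}

theorem extend {x : E} {t δ : ℝ} (ht : 0 ≤ t) (hδ : 0 ≤ δ) {γ : ℝ → E}
    (hV : ContDiff ℝ 1 V) (hγ : IsIntegralCurveOn γ (fun _ ↦ V) (Icc 0 t)) (hγ0 : γ 0 = x)
    (h : HasLocalFlow V x t) (h' : HasLocalFlow V (γ t) δ) : HasLocalFlow V x (t + δ) := by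
  obtain ⟨U, hU, α, hα, hc⟩ := h
  obtain ⟨W, hW, β, hβ, hc'⟩ := h'
  have htt : t ∈ Icc 0 t := right_mem_Icc.2 ht
  have hαx : α x t = γ t := by
    obtain ⟨h0, hαx⟩ := hα x (mem_of_mem_nhds hU)
    exact hαx.eqOn_Icc hV hγ (h0.trans hγ0.symm) htt
  have hct : ContinuousOn (fun y ↦ α y t) U :=
    hc.comp (f := fun y : E ↦ (y, t)) (by fun_prop) fun y hy ↦ ⟨hy, htt⟩
  have hpre : {y | α y t ∈ W} ∈ 𝓝 x := by
    refine (hct.continuousAt hU).preimage_mem_nhds ?_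
    rwa [hαx]
  refine ⟨U ∩ {y | α y t ∈ W}, inter_mem hU hpre,
    fun y s ↦ α y (min s t) + (β (α y t) (max (s - t) 0) - α y t), ?_, ?_⟩
  · rintro y ⟨hyU, hyW⟩
    obtain ⟨h0, hαy⟩ := hα y hyU
    obtain ⟨h0', hβy⟩ := hβ _ hyW
    exact ⟨by simp [min_eq_left ht, max_eq_right (neg_nonpos.2 ht), h0, h0'],
      hαy.concat ht hδ hβy h0'⟩
  · have hc1 : ContinuousOn (fun q : E × ℝ ↦ α q.1 t)
        ((U ∩ {y | α y t ∈ W}) ×ˢ Icc 0 (t + δ)) :=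
      hct.comp continuousOn_fst fun q hq ↦ hq.1.1
    have hc2 : ContinuousOn (fun q : E × ℝ ↦ α q.1 (min q.2 t))
        ((U ∩ {y | α y t ∈ W}) ×ˢ Icc 0 (t + δ)) :=
      hc.comp (f := fun q : E × ℝ ↦ (q.1, min q.2 t)) (by fun_prop)
        fun q hq ↦ ⟨hq.1.1, le_min hq.2.1 ht, min_le_right _ _⟩
    refine hc2.add (ContinuousOn.sub ?_ hc1)
    refine hc'.comp (f := fun q : E × ℝ ↦ (α q.1 t, max (q.2 - t) 0))
      (hc1.prodMk (by fun_prop)) ?_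
    exact fun q hq ↦ ⟨hq.1.2, le_max_right _ _, max_le (by linarith [hq.2.2]) hδ⟩

theorem of_bounded [CompleteSpace E] (hV : ContDiff ℝ 1 V) {C : ℝ} (hC : ∀ x, ‖V x‖ ≤ C)
    (x : E) (T : ℝ) : HasLocalFlow V x T := by
  by_contra hT
  set S : Set ℝ := {t | 0 ≤ t ∧ HasLocalFlow V x t}
  have hS0 : S.Nonempty := by
    obtain ⟨δ, hδ, h⟩ := eventually_of_contDiff hV x
    exact ⟨δ, hδ.le, h.self_of_nhds⟩
  have hSb : BddAbove S := ⟨T, fun t ht ↦ le_of_not_ge fun h ↦ hT (ht.2.mono h)⟩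
  have hex : ∀ t, ∃ γ : ℝ → E, t ∈ S →
      γ 0 = x ∧ IsIntegralCurveOn γ (fun _ ↦ V) (Icc 0 t) := by
    intro t
    by_cases ht : t ∈ S
    · obtain ⟨U, hU, α, hα, -⟩ := ht.2
      exact ⟨α x, fun _ ↦ hα x (mem_of_mem_nhds hU)⟩
    · exact ⟨fun _ ↦ x, fun h ↦ absurd h ht⟩
  choose γ hγ using hex
  have hlip : LipschitzOnWith C.toNNReal (fun t ↦ γ t t) S := by
    have key : ∀ s ∈ S, ∀ t ∈ S, s ≤ t → ‖γ t t - γ s s‖ ≤ C * (t - s) := by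
      intro s hs t ht hst
      have hsub : Icc 0 s ⊆ Icc 0 t := Icc_subset_Icc_right hst
      have heq : γ s s = γ t s :=
        (hγ s hs).2.eqOn_Icc hV ((hγ t ht).2.mono hsub) ((hγ s hs).1.trans (hγ t ht).1.symm)
          ⟨hs.1, le_rfl⟩
      rw [heq]
      exact norm_image_sub_le_of_norm_deriv_le_segment'
        ((hγ t ht).2.mono (Icc_subset_Icc_left hs.1)) (fun _ _ ↦ hC _) t ⟨hst, le_rfl⟩
    have hC0 : 0 ≤ C := (norm_nonneg _).trans (hC x)
    refine LipschitzOnWith.of_dist_le_mul fun s hs t ht ↦ ?_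
    rw [Real.coe_toNNReal _ hC0]
    rcases le_total s t with hst | hst
    · rw [dist_comm, dist_comm s, dist_eq_norm, Real.dist_eq, abs_of_nonneg (sub_nonneg.2 hst)]
      exact key s hs t ht hst
    · rw [dist_eq_norm, Real.dist_eq, abs_of_nonneg (sub_nonneg.2 hst)]
      exact key t ht s hs hst
  obtain ⟨u, -, hu, huS⟩ := exists_seq_tendsto_sSup hS0 hSb
  have hcauchy : CauchySeq fun n ↦ γ (u n) (u n) :=
    hlip.cauchySeq_comp hu.cauchySeq (range_subset_iff.2 huS)
  obtain ⟨p, hp⟩ := cauchySeq_tendsto_of_complete hcauchy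
  obtain ⟨δ, hδ, hflow⟩ := eventually_of_contDiff hV p
  obtain ⟨n, hn, hun⟩ :=
    ((hp.eventually hflow).and (hu.eventually (lt_mem_nhds (sub_lt_self (sSup S) hδ)))).exists
  have hext : HasLocalFlow V x (u n + δ) :=
    extend (huS n).1 hδ.le hV (hγ _ (huS n)).2 (hγ _ (huS n)).1 (huS n).2 hn
  have := le_csSup hSb (show u n + δ ∈ S from ⟨by linarith [(huS n).1], hext⟩)
  linarith

end HasLocalFlow

theorem ContDiff.exists_semiflow_of_bounded {E : Type*} [NormedAddCommGroup E] [NormedSpace ℝ E]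
    [CompleteSpace E] {V : E → E} (hV : ContDiff ℝ 1 V) {C : ℝ} (hC : ∀ x, ‖V x‖ ≤ C) (T : ℝ) :
    ∃ Φ : E → ℝ → E, (∀ x, Φ x 0 = x) ∧
      (∀ x, IsIntegralCurveOn (Φ x) (fun _ ↦ V) (Icc 0 T)) ∧
      ContinuousOn (fun q : E × ℝ ↦ Φ q.1 q.2) (univ ×ˢ Icc 0 T) := by
  choose U hU α hα hc using fun x ↦ HasLocalFlow.of_bounded hV hC x T
  have hself : ∀ x, α x x 0 = x ∧ IsIntegralCurveOn (α x x) (fun _ ↦ V) (Icc 0 T) :=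
    fun x ↦ hα x x (mem_of_mem_nhds (hU x))
  refine ⟨fun x ↦ α x x, fun x ↦ (hself x).1, fun x ↦ (hself x).2, ?_⟩
  rintro ⟨x, t⟩ ⟨-, ht⟩
  have heq : EqOn (fun q : E × ℝ ↦ α q.1 q.1 q.2) (fun q ↦ α x q.1 q.2) (U x ×ˢ Icc 0 T) :=
    fun q hq ↦ (hself q.1).2.eqOn_Icc hV (hα x q.1 hq.1).2
      ((hself q.1).1.trans (hα x q.1 hq.1).1.symm) hq.2
  refine (((hc x).congr heq) (x, t) ⟨mem_of_mem_nhds (hU x), ht⟩).mono_of_mem_nhdsWithin ?_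
  rw [nhdsWithin_prod_eq, nhdsWithin_univ]
  exact prod_mem_prod (hU x) self_mem_nhdsWithin

section GradientField

variable {X : Type*} [NormedAddCommGroup X] [InnerProductSpace ℝ X] [CompleteSpace X]

/-- The gradient field of `φ`, normalized so that `φ` grows at rate `ρ (φ u)` along it. -/
noncomputable def normalizedGradient (φ : X → ℝ) (ρ : ℝ → ℝ) (u : X) : X :=
  (ρ (φ u) * (‖gradient φ u‖ ^ 2)⁻¹) • gradient φ u

theorem norm_gradient (φ : X → ℝ) (u : X) : ‖gradient φ u‖ = ‖fderiv ℝ φ u‖ :=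
  (InnerProductSpace.toDual ℝ X).symm.norm_map _

theorem ContDiff.gradient_one {φ : X → ℝ} (hφ : ContDiff ℝ 2 φ) :
    ContDiff ℝ 1 (gradient φ) :=
  (InnerProductSpace.toDual ℝ X).symm.contDiff.comp (hφ.fderiv_right (by norm_num))

variable {φ : X → ℝ} {ρ : ℝ → ℝ} {a b m : ℝ}

theorem fderiv_normalizedGradient (hm : 0 < m)
    (hgrad : ∀ u ∈ φ ⁻¹' Icc a b, m ≤ ‖fderiv ℝ φ u‖) (hρ0 : ∀ c ∉ Icc a b, ρ c = 0) (u : X) :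
    fderiv ℝ φ u (normalizedGradient φ ρ u) = ρ (φ u) := by
  by_cases hu : φ u ∈ Icc a b
  · have hpos : 0 < ‖gradient φ u‖ := by
      rw [norm_gradient]
      exact hm.trans_le (hgrad u hu)
    rw [normalizedGradient, map_smul, ← toDual_gradient, InnerProductSpace.toDual_apply_apply,
      real_inner_self_eq_norm_sq, smul_eq_mul, inv_mul_cancel_right₀ (by positivity)]
  · simp [normalizedGradient, hρ0 _ hu]

theorem norm_normalizedGradient_le (hm : 0 < m)
    (hgrad : ∀ u ∈ φ ⁻¹' Icc a b, m ≤ ‖fderiv ℝ φ u‖) (hρ0 : ∀ c ∉ Icc a b, ρ c = 0)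
    (hρ : ∀ c, ρ c ∈ Icc (0 : ℝ) 1) (u : X) : ‖normalizedGradient φ ρ u‖ ≤ m⁻¹ := by
  by_cases hu : φ u ∈ Icc a b
  · have hle : m ≤ ‖gradient φ u‖ := by
      rw [norm_gradient]
      exact hgrad u hu
    have hpos : 0 < ‖gradient φ u‖ := hm.trans_le hle
    have heq : ‖normalizedGradient φ ρ u‖ = ρ (φ u) * ‖gradient φ u‖⁻¹ := by
      rw [normalizedGradient, norm_smul, Real.norm_of_nonneg
        (mul_nonneg (hρ _).1 (by positivity))]
      field_simp
    rw [heq]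
    calc ρ (φ u) * ‖gradient φ u‖⁻¹ ≤ 1 * m⁻¹ := by
          gcongr
          exact (hρ _).2
      _ = m⁻¹ := one_mul _
  · simp [normalizedGradient, hρ0 _ hu, hm.le]

theorem contDiff_normalizedGradient (hφ : ContDiff ℝ 2 φ) (hρc : ContDiff ℝ 1 ρ) (hm : 0 < m)
    (hgrad : ∀ u ∈ φ ⁻¹' Icc a b, m ≤ ‖fderiv ℝ φ u‖) (hρ0 : ∀ c ∉ Icc a b, ρ c = 0) :
    ContDiff ℝ 1 (normalizedGradient φ ρ) := by
  rw [contDiff_iff_contDiffAt]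
  intro u
  by_cases hu : φ u ∈ Icc a b
  · have hne : ‖gradient φ u‖ ^ 2 ≠ 0 := by
      rw [norm_gradient]
      exact pow_ne_zero _ (hm.trans_le (hgrad u hu)).ne'
    have hg := hφ.gradient_one.contDiffAt (x := u)
    have hρφ : ContDiffAt ℝ 1 (fun u ↦ ρ (φ u)) u :=
      (hρc.comp (hφ.of_le (by norm_num))).contDiffAt
    exact (hρφ.mul ((hg.norm_sq ℝ).inv hne)).smul hg
  · have hopen : φ ⁻¹' (Icc a b)ᶜ ∈ 𝓝 u :=
      (isClosed_Icc.isOpen_compl.preimage hφ.continuous).mem_nhds hu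
    refine (contDiffAt_const (c := (0 : X))).congr_of_eventuallyEq ?_
    filter_upwards [hopen] with w hw
    simp [normalizedGradient, hρ0 _ hw]

theorem apply_integralCurve_normalizedGradient (hφ : Differentiable ℝ φ) (hm : 0 < m)
    (hgrad : ∀ u ∈ φ ⁻¹' Icc a b, m ≤ ‖fderiv ℝ φ u‖) (hρ0 : ∀ c ∉ Icc a b, ρ c = 0)
    (hρ : ∀ c, ρ c ∈ Icc (0 : ℝ) 1) {a' b' : ℝ} (hρ1 : ∀ c ∈ Icc a' b', ρ c = 1)
    {γ : ℝ → X} {t : ℝ} (ht : 0 ≤ t)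
    (hγ : IsIntegralCurveOn γ (fun _ ↦ normalizedGradient φ ρ) (Icc 0 t))
    (ha : a' ≤ φ (γ 0)) (hb : φ (γ 0) + t ≤ b') : φ (γ t) = φ (γ 0) + t := by
  have hder : ∀ s ∈ Icc 0 t, HasDerivWithinAt (φ ∘ γ) (ρ (φ (γ s))) (Icc 0 t) s := by
    intro s hs
    have := (hφ (γ s)).hasFDerivAt.comp_hasDerivWithinAt s (hγ s hs)
    rwa [fderiv_normalizedGradient hm hgrad hρ0] at this
  have hcont : ContinuousOn (φ ∘ γ) (Icc 0 t) := fun s hs ↦ (hder s hs).continuousWithinAt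
  have hder' : ∀ s ∈ interior (Icc 0 t), HasDerivWithinAt (φ ∘ γ) (ρ (φ (γ s)))
      (interior (Icc 0 t)) s := fun s hs ↦
    (hder s (interior_subset hs)).mono interior_subset
  have hmono : MonotoneOn (φ ∘ γ) (Icc 0 t) :=
    monotoneOn_of_hasDerivWithinAt_nonneg (convex_Icc 0 t) hcont hder' fun s _ ↦ (hρ _).1
  have hanti : AntitoneOn (fun s ↦ φ (γ s) - s) (Icc 0 t) :=
    antitoneOn_of_hasDerivWithinAt_nonpos (convex_Icc 0 t) (hcont.sub continuousOn_id)
      (fun s hs ↦ (hder' s hs).sub (hasDerivWithinAt_id _ _)) fun s _ ↦ sub_nonpos.2 (hρ _).2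
  have h0 : (0 : ℝ) ∈ Icc 0 t := left_mem_Icc.2 ht
  have hone : ∀ s ∈ Icc 0 t, ρ (φ (γ s)) = 1 := by
    intro s hs
    refine hρ1 _ ⟨ha.trans (hmono h0 hs hs.1), ?_⟩
    have := hanti h0 hs hs.1
    simp only [sub_zero] at this
    linarith [hs.2]
  have hmono' : MonotoneOn (fun s ↦ φ (γ s) - s) (Icc 0 t) :=
    monotoneOn_of_hasDerivWithinAt_nonneg (convex_Icc 0 t) (hcont.sub continuousOn_id)
      (fun s hs ↦ (hder' s hs).sub (hasDerivWithinAt_id _ _)) fun s hs ↦ by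
        simp [hone s (interior_subset hs)]
  have htt : t ∈ Icc 0 t := right_mem_Icc.2 ht
  have h1 := hanti h0 htt ht
  have h2 := hmono' h0 htt ht
  simp only [sub_zero] at h1 h2
  linarith

theorem exists_continuous_map_to_higher_level (hφ : ContDiff ℝ 2 φ) {h ε : ℝ} (hε : 0 < ε)
    (hgrad : ∀ u ∈ φ ⁻¹' Icc (h - 2 * ε) (h + 2 * ε), 2 * ε ≤ ‖fderiv ℝ φ u‖) :
    ∃ η : X → X, Continuous η ∧
      (∀ u, φ u ∉ Ioo (h - 2 * ε) (h - ε / 3) → η u = u) ∧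
      ∀ u, φ u ∈ Icc (h - ε) (h - ε / 2) → φ (η u) = h + 5 / 4 * ε := by
  let ρ : ContDiffBump h := ⟨3 / 2 * ε, 2 * ε, by positivity, by linarith⟩
  have hρ0 : ∀ c ∉ Icc (h - 2 * ε) (h + 2 * ε), ρ c = 0 := by
    intro c hc
    rw [← Real.closedBall_eq_Icc, Metric.mem_closedBall, not_le] at hc
    exact ρ.zero_of_le_dist hc.le
  have hρ1 : ∀ c ∈ Icc (h - 3 / 2 * ε) (h + 3 / 2 * ε), ρ c = 1 := by
    intro c hc
    rw [← Real.closedBall_eq_Icc] at hc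
    exact ρ.one_of_mem_closedBall hc
  have hρ : ∀ c, ρ c ∈ Icc (0 : ℝ) 1 := fun c ↦ ⟨ρ.nonneg, ρ.le_one⟩
  have hm : 0 < 2 * ε := by positivity
  obtain ⟨Φ, hΦ0, hΦ, hΦc⟩ :=
    (contDiff_normalizedGradient hφ ρ.contDiff hm hgrad hρ0).exists_semiflow_of_bounded
      (norm_normalizedGradient_le hm hgrad hρ0 hρ) (4 * ε)
  let χ : ℝ → ℝ := fun c ↦ max 0 (min 1 (min ((c - (h - 2 * ε)) / ε) ((h - ε / 3 - c) / (ε / 6))))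
  let τ : X → ℝ := fun u ↦ χ (φ u) * max 0 (min (4 * ε) (h + 5 / 4 * ε - φ u))
  have hφc := hφ.continuous
  have hτc : Continuous τ := by fun_prop
  have hτ : ∀ u, τ u ∈ Icc 0 (4 * ε) := by
    intro u
    have h4 : max 0 (min (4 * ε) (h + 5 / 4 * ε - φ u)) ≤ 4 * ε :=
      max_le (by positivity) (min_le_left _ _)
    exact ⟨mul_nonneg (le_max_left _ _) (le_max_left _ _),
      (mul_le_of_le_one_left (le_max_left _ _) (max_le zero_le_one (min_le_left _ _))).trans h4⟩
  refine ⟨fun u ↦ Φ u (τ u), ?_, ?_, ?_⟩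
  · rw [← continuousOn_univ]
    exact hΦc.comp (f := fun u ↦ (u, τ u)) (by fun_prop) fun u _ ↦ ⟨mem_univ _, hτ u⟩
  · intro u hu
    have hχ : χ (φ u) = 0 := by
      refine max_eq_left ((min_le_right _ _).trans ?_)
      rw [mem_Ioo, not_and_or, not_lt, not_lt] at hu
      rcases hu with hu | hu
      · exact (min_le_left _ _).trans (div_nonpos_of_nonpos_of_nonneg (by linarith) hε.le)
      · exact (min_le_right _ _).trans
          (div_nonpos_of_nonpos_of_nonneg (by linarith) (by positivity))
    simp [τ, hχ, hΦ0]
  · rintro u ⟨hu1, hu2⟩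
    have hχ : χ (φ u) = 1 := by
      have h1 : 1 ≤ (φ u - (h - 2 * ε)) / ε := by rw [le_div_iff₀ hε]; linarith
      have h2 : 1 ≤ (h - ε / 3 - φ u) / (ε / 6) := by
        rw [le_div_iff₀ (by positivity)]
        linarith
      simp only [χ]
      rw [min_eq_left (le_min h1 h2), max_eq_right zero_le_one]
    have hτu : τ u = h + 5 / 4 * ε - φ u := by
      simp only [τ, hχ, one_mul]
      rw [min_eq_right (by linarith), max_eq_right (by linarith)]
    have := apply_integralCurve_normalizedGradient (hφ.differentiable (by norm_num)) hm hgrad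
      hρ0 hρ hρ1 (hτ u).1 ((hΦ u).mono (Icc_subset_Icc_right (hτ u).2))
      (by rw [hΦ0]; linarith) (by rw [hΦ0, hτu]; linarith)
    rw [this, hΦ0, hτu]
    ring

end GradientField

/-- Lemma 2.1 (new quantitative deformation lemma). -/
theorem new_quantitative_deformation_lemma
    {X : Type*} [NormedAddCommGroup X] [InnerProductSpace ℝ X] [CompleteSpace X]
    (φ : X → ℝ) (hφ : ContDiff ℝ 2 φ) (h ε : ℝ) (hε : 0 < ε)
    (hgrad : ∀ u ∈ φ ⁻¹' Set.Icc (h - 2 * ε) (h + 2 * ε), 2 * ε ≤ ‖fderiv ℝ φ u‖)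
    (D : Set X) (hD : D ⊆ φ ⁻¹' Set.Icc (h - ε / 3) (h + ε / 3)) :
    ∃ η : X → X, Continuous η ∧
      (∀ u, u ∉ (φ ⁻¹' Set.Icc (h - 2 * ε) (h + 2 * ε)) \ D → η u = u) ∧
      (η '' (φ ⁻¹' Set.Icc (h - ε) (h - ε / 2)) ⊆
        φ ⁻¹' Set.Icc (h + ε) (h + 3 / 2 * ε)) ∧
      (η '' (φ ⁻¹' Set.Icc (h + ε / 2) (h + ε)) ⊆
        φ ⁻¹' Set.Icc (h - 3 / 2 * ε) (h - ε)) := by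
  obtain ⟨η₁, hc₁, hid₁, hup⟩ := exists_continuous_map_to_higher_level hφ hε hgrad
  have hgrad' : ∀ u ∈ (-φ) ⁻¹' Icc (-h - 2 * ε) (-h + 2 * ε), 2 * ε ≤ ‖fderiv ℝ (-φ) u‖ := by
    rintro u ⟨hu1, hu2⟩
    rw [fderiv_neg, norm_neg]
    simp only [Pi.neg_apply] at hu1 hu2
    exact hgrad u ⟨by linarith, by linarith⟩
  obtain ⟨η₂, hc₂, hid₂, hdown⟩ := exists_continuous_map_to_higher_level hφ.neg hε hgrad'
  simp only [mem_Ioo, mem_Icc] at hid₁ hid₂ hup hdown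
  refine ⟨fun u ↦ if φ u ≤ h then η₁ u else η₂ u,
    hc₁.if_le hc₂ hφ.continuous continuous_const fun u hu ↦ ?_, fun u hu ↦ ?_, ?_, ?_⟩
  · rw [hid₁ u fun h' ↦ by linarith [h'.2], hid₂ u fun h' ↦ by linarith [h'.2]]
  · have hu' : φ u ∉ Icc (h - 2 * ε) (h + 2 * ε) ∨ φ u ∈ Icc (h - ε / 3) (h + ε / 3) := by
      by_cases huD : u ∈ D
      · exact Or.inr (hD huD)
      · exact Or.inl fun h' ↦ hu ⟨h', huD⟩
    have h₁ : η₁ u = u := hid₁ u fun h' ↦ by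
      rcases hu' with h'' | h''
      · exact h'' ⟨h'.1.le, by linarith [h'.2]⟩
      · exact absurd h''.1 (not_le.2 h'.2)
    have h₂ : η₂ u = u := hid₂ u fun h' ↦ by
      rcases hu' with h'' | h''
      · exact h'' ⟨by linarith [h'.2], by linarith [h'.1]⟩
      · linarith [h''.2, h'.2]
    simp only [h₁, h₂, ite_self]
  · rintro _ ⟨u, ⟨hu1, hu2⟩, rfl⟩
    have := hup u ⟨hu1, hu2⟩
    simp only [mem_preimage, if_pos (show φ u ≤ h by linarith), this]
    exact ⟨by linarith, by linarith⟩
  · rintro _ ⟨u, ⟨hu1, hu2⟩, rfl⟩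
    have := hdown u ⟨by linarith, by linarith⟩
    simp only [mem_preimage, if_neg (show ¬ φ u ≤ h by linarith)]
    exact ⟨by linarith, by linarith⟩
end

section
/- Let X be a finite-dimensional real Banach space and φ ∈ C¹(X, ℝ). Suppose there exist e ∈ X, a ∈ ℝ and r > 0 with ‖e‖ > r such that (i) inf_{‖u‖=r} φ(u) ≥ a; (ii) φ(0) ≤ a and φ(e) ≤ a; (iii) any sequence (uₙ) in X such that φ(uₙ) converges to a limit ≥ a and φ′(uₙ) → 0 possesses a convergent subsequence. Then c := inf_{γ∈Γ} max_{t∈[0,1]} φ(γ(t)), where Γ := {γ ∈ C([0,1], X) : γ(0) = 0, γ(1) = e}, is a critical value of φ. -/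
open Set Filter Topology

/-- On a finite-dimensional space, continuous linear forms of norm at least `β` admit a continuous
choice of vectors in the unit ball on which they are uniformly positive. -/
theorem exists_continuous_pseudoGradient {X : Type*} [NormedAddCommGroup X] [NormedSpace ℝ X]
    [FiniteDimensional ℝ X] {β : ℝ} (hβ : 0 < β) :
    ∃ P : (X →L[ℝ] ℝ) → X, Continuous P ∧ ∃ μ : ℝ, 0 < μ ∧ (∀ f, ‖P f‖ ≤ 1) ∧
      (∀ f : X →L[ℝ] ℝ, 0 ≤ f (P f)) ∧ ∀ f : X →L[ℝ] ℝ, β ≤ ‖f‖ → μ ≤ f (P f) := by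
  let b := Module.finBasis ℝ X
  obtain ⟨C, hC, hCb⟩ := b.exists_opNorm_le (F := ℝ)
  set s : ℝ := β / (2 * C) with hs
  have hs0 : 0 < s := by positivity
  set S : ℝ := ∑ i, ‖b i‖ with hS
  have hS0 : 0 ≤ S := Finset.sum_nonneg fun i _ => norm_nonneg _
  set k : ℝ := (1 + s * S)⁻¹ with hk
  have hk0 : 0 < k := by positivity
  let q : ℝ → ℝ := fun y => max (-s) (min y s)
  have hq : ∀ y, |q y| ≤ s := fun y =>
    abs_le.2 ⟨le_max_left _ _, max_le (by linarith) (min_le_right _ _)⟩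
  have hyq : ∀ y, 0 ≤ y * q y := fun y => by
    rcases le_total 0 y with h | h
    · exact mul_nonneg h (le_max_of_le_right (le_min h hs0.le))
    · exact mul_nonneg_of_nonpos_of_nonpos h
        (max_le (by linarith) ((min_le_left _ _).trans h))
  have hyq' : ∀ y, s < |y| → s ^ 2 ≤ y * q y := fun y hy => by
    rcases lt_abs.1 hy with h | h
    · have : q y = s := by simp only [q]; rw [min_eq_right h.le, max_eq_right (by linarith)]
      rw [this]; nlinarith
    · have : q y = -s := by
        simp only [q]; rw [min_eq_left (by linarith), max_eq_left (by linarith)]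
      rw [this]; nlinarith
  have key : ∀ f : X →L[ℝ] ℝ, f (k • ∑ i, q (f (b i)) • b i) =
      k * ∑ i, f (b i) * q (f (b i)) := fun f => by
    simp [map_sum, mul_comm]
  refine ⟨fun f => k • ∑ i, q (f (b i)) • b i, by fun_prop, k * s ^ 2, by positivity,
    fun f => ?_, fun f => ?_, fun f hf => ?_⟩
  · rw [norm_smul, Real.norm_of_nonneg hk0.le, hk, inv_mul_le_one₀ (by positivity)]
    calc ‖∑ i, q (f (b i)) • b i‖ ≤ ∑ i, s * ‖b i‖ := by
          refine norm_sum_le_of_le _ fun i _ => ?_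
          rw [norm_smul]
          exact mul_le_mul_of_nonneg_right (hq _) (norm_nonneg _)
      _ = s * S := by rw [← Finset.mul_sum]
      _ ≤ 1 + s * S := by linarith
  · rw [key]
    exact mul_nonneg hk0.le (Finset.sum_nonneg fun i _ => hyq _)
  · rw [key]
    refine mul_le_mul_of_nonneg_left ?_ hk0.le
    obtain ⟨i, hi⟩ : ∃ i, s < |f (b i)| := by
      by_contra! h
      have h1 : ‖f‖ ≤ C * s := hCb hs0.le h
      have h2 : C * s = β / 2 := by rw [hs]; field_simp
      linarith
    exact (hyq' _ hi).trans
      (Finset.single_le_sum (f := fun i => f (b i) * q (f (b i)))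
        (fun i _ => hyq _) (Finset.mem_univ i))

/-- The first order expansion of a `C¹` function is uniform on bounded subsets of a
finite-dimensional space. -/
theorem ContDiff.exists_uniform_taylor_bound {X : Type*} [NormedAddCommGroup X] [NormedSpace ℝ X]
    [FiniteDimensional ℝ X] {φ : X → ℝ} (hφ : ContDiff ℝ 1 φ) (R : ℝ) {η : ℝ} (hη : 0 < η) :
    ∃ d > 0, ∀ x y : X, ‖x‖ ≤ R → ‖y - x‖ < d →
      |φ y - φ x - fderiv ℝ φ x (y - x)| ≤ η * ‖y - x‖ := by
  have : ProperSpace X := FiniteDimensional.proper ℝ X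
  have huc := (isCompact_closedBall (0 : X) (R + 1)).uniformContinuousOn_of_continuous
    (hφ.continuous_fderiv one_ne_zero).continuousOn
  obtain ⟨d, hd, H⟩ := Metric.uniformContinuousOn_iff.1 huc η hη
  refine ⟨min d 1, by positivity, fun x y hx hxy => ?_⟩
  have hball : ∀ z ∈ Metric.ball x (min d 1), ‖fderiv ℝ φ z - fderiv ℝ φ x‖ ≤ η := by
    intro z hz
    rw [Metric.mem_ball, lt_min_iff] at hz
    rw [← dist_eq_norm]
    refine (H z ?_ x ?_ hz.1).le
    · rw [mem_closedBall_zero_iff]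
      have h1 := hz.2
      rw [dist_eq_norm] at h1
      have h2 := norm_sub_norm_le z x
      linarith
    · rw [mem_closedBall_zero_iff]; linarith
  exact (convex_ball x (min d 1)).norm_image_sub_le_of_norm_hasFDerivWithin_le'
    (fun z _ => ((hφ.differentiable one_ne_zero) z).hasFDerivAt.hasFDerivWithinAt) hball
    (Metric.mem_ball_self (by positivity)) (by rwa [Metric.mem_ball, dist_eq_norm])

/-- If a closed set `F` avoiding `p` and `e` meets every path from `p` to `e`, if `c ≤ φ` on `F`,
and if `φ` can be kept below any level above `c` along suitable paths, then there are almost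
critical points at levels near `c`. -/
theorem exists_almost_critical_of_linking {X : Type*} [NormedAddCommGroup X] [NormedSpace ℝ X]
    [FiniteDimensional ℝ X] {φ : X → ℝ} (hφ : ContDiff ℝ 1 φ) {F : Set X} (hF : IsClosed F)
    {p e : X} (hp : p ∉ F) (he : e ∉ F) {c : ℝ} (hc : ∀ x ∈ F, c ≤ φ x)
    (hmeet : ∀ γ : ℝ → X, ContinuousOn γ (Icc 0 1) → γ 0 = p → γ 1 = e →
      ∃ t ∈ Icc (0 : ℝ) 1, γ t ∈ F)
    (hlow : ∀ ε > 0, ∃ γ : ℝ → X, ContinuousOn γ (Icc 0 1) ∧ γ 0 = p ∧ γ 1 = e ∧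
      ∀ t ∈ Icc (0 : ℝ) 1, φ (γ t) ≤ c + ε)
    {β : ℝ} (hβ : 0 < β) :
    ∃ x, |φ x - c| ≤ β ∧ ‖fderiv ℝ φ x‖ ≤ β := by
  by_contra! hno
  obtain ⟨P, hPc, μ, hμ, hP1, hP0, hPμ⟩ := exists_continuous_pseudoGradient (X := X) hβ
  have hFne : F.Nonempty := by
    obtain ⟨γ, h1, h2, h3, -⟩ := hlow 1 one_pos
    obtain ⟨t, -, ht⟩ := hmeet γ h1 h2 h3
    exact ⟨_, ht⟩
  set δ : ℝ := min (Metric.infDist p F) (min (Metric.infDist e F) 1) with hδ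
  have hδ0 : 0 < δ := lt_min ((hF.notMem_iff_infDist_pos hFne).1 hp)
    (lt_min ((hF.notMem_iff_infDist_pos hFne).1 he) one_pos)
  have hδp : δ ≤ Metric.infDist p F := min_le_left _ _
  have hδe : δ ≤ Metric.infDist e F := (min_le_right _ _).trans (min_le_left _ _)
  have hδ1 : δ ≤ 1 := (min_le_right _ _).trans (min_le_right _ _)
  let χ : X → ℝ := fun x => max 0 (1 - Metric.infDist x F / δ)
  have hχc : Continuous χ :=
    continuous_const.max (continuous_const.sub ((Metric.continuous_infDist_pt F).div_const δ))
  have hχ0 : ∀ x, 0 ≤ χ x := fun x => le_max_left _ _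
  have hχ1 : ∀ x, χ x ≤ 1 := fun x => max_le zero_le_one (by
    have : 0 ≤ Metric.infDist x F / δ := div_nonneg Metric.infDist_nonneg hδ0.le
    linarith)
  have hχz : ∀ x, δ ≤ Metric.infDist x F → χ x = 0 := fun x hx => max_eq_left (by
    have := (one_le_div hδ0).2 hx
    linarith)
  have hχh : ∀ x, Metric.infDist x F ≤ δ / 2 → 1 / 2 ≤ χ x := fun x hx =>
    le_max_of_le_right (by
      have : Metric.infDist x F / δ ≤ 1 / 2 := by rw [div_le_iff₀ hδ0]; linarith
      linarith)
  let W : X → X := fun x => χ x • P (fderiv ℝ φ x)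
  have hWc : Continuous W := hχc.smul (hPc.comp (hφ.continuous_fderiv one_ne_zero))
  have hW1 : ∀ x, ‖W x‖ ≤ 1 := fun x => by
    rw [norm_smul, Real.norm_of_nonneg (hχ0 x)]
    exact mul_le_one₀ (hχ1 x) (norm_nonneg _) (hP1 _)
  have hφW : ∀ x, fderiv ℝ φ x (W x) = χ x * fderiv ℝ φ x (P (fderiv ℝ φ x)) := fun x => by
    simp [W]
  have hφW0 : ∀ x, 0 ≤ fderiv ℝ φ x (W x) := fun x => by
    rw [hφW]; exact mul_nonneg (hχ0 x) (hP0 _)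
  have hφWμ : ∀ x, Metric.infDist x F ≤ δ / 2 → |φ x - c| ≤ β →
      μ / 2 ≤ fderiv ℝ φ x (W x) := fun x hx hxc => by
    rw [hφW]
    have h1 := hPμ _ (hno x hxc).le
    have h2 := hχh x hx
    nlinarith
  set T : ℝ := δ / 2 with hT
  have hT0 : 0 < T := by positivity
  have hT1 : T ≤ 1 := by linarith
  set ε : ℝ := min (β / 2) (T * μ / 8) with hε
  have hε0 : 0 < ε := by positivity
  have hεβ : ε ≤ β / 2 := min_le_left _ _
  have hεμ : ε ≤ T * μ / 8 := min_le_right _ _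
  set η : ℝ := min (β / 2) (μ / 8) with hη
  have hη0 : 0 < η := by positivity
  have hηβ : η ≤ β / 2 := min_le_left _ _
  have hημ : η ≤ μ / 8 := min_le_right _ _
  obtain ⟨γ, hγc, hγ0, hγ1, hγ⟩ := hlow ε hε0
  obtain ⟨R, hR⟩ := (isCompact_Icc.image_of_continuousOn hγc).isBounded.exists_norm_le
  obtain ⟨d, hd, htay⟩ := hφ.exists_uniform_taylor_bound (R + 1) hη0
  obtain ⟨N, hN⟩ := exists_nat_gt (T / d)
  have hN0 : (0 : ℝ) < N := lt_trans (by positivity) hN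
  set h : ℝ := T / N with hh
  have hh0 : 0 < h := by positivity
  have hNh : N * h = T := by rw [hh]; field_simp
  have hhd : h < d := by
    rw [hh, div_lt_iff₀ hN0]; rw [div_lt_iff₀ hd] at hN; linarith
  let G : X → X := fun x => x - h • W x
  have hGc : Continuous G := continuous_id.sub (continuous_const.smul hWc)
  have hGd : ∀ x, ‖G x - x‖ ≤ h := fun x => by
    have : G x - x = -(h • W x) := by simp [G]
    rw [this, norm_neg, norm_smul, Real.norm_of_nonneg hh0.le]
    exact mul_le_of_le_one_right hh0.le (hW1 x)
  have hGfix : ∀ x, δ ≤ Metric.infDist x F → G x = x := fun x hx => by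
    simp [G, W, hχz x hx]
  have hGφ : ∀ x, ‖x‖ ≤ R + 1 → φ (G x) ≤ φ x - h * fderiv ℝ φ x (W x) + η * h := by
    intro x hx
    have h1 := (abs_le.1 (htay x (G x) hx ((hGd x).trans_lt hhd))).2
    have h2 : G x - x = -(h • W x) := by simp [G]
    have h3 : fderiv ℝ φ x (G x - x) = -(h * fderiv ℝ φ x (W x)) := by rw [h2]; simp
    have h4 := mul_le_mul_of_nonneg_left (hGd x) hη0.le
    linarith
  obtain ⟨t, ht, htF⟩ := hmeet (fun t => G^[N] (γ t))
    ((hGc.iterate N).comp_continuousOn hγc)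
    (by simp only [hγ0]; exact Function.iterate_fixed (hGfix p hδp) N)
    (by simp only [hγ1]; exact Function.iterate_fixed (hGfix e hδe) N)
  set x : ℕ → X := fun k => G^[k] (γ t) with hx
  have hxs : ∀ k, x (k + 1) = G (x k) := fun k => Function.iterate_succ_apply' G k _
  have hxN : x N ∈ F := htF
  have hxd : ∀ k m, ‖x (k + m) - x k‖ ≤ m * h := by
    intro k m
    induction m with
    | zero => simp
    | succ m ih =>
      have h1 := hGd (x (k + m))
      rw [← hxs] at h1
      have h2 := norm_sub_le_norm_sub_add_norm_sub (x (k + m + 1)) (x (k + m)) (x k)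
      rw [← add_assoc]
      push_cast
      linarith
  have hkT : ∀ k ≤ N, (k : ℝ) * h ≤ T := fun k hk => by
    rw [← hNh]
    exact mul_le_mul_of_nonneg_right (by exact_mod_cast hk) hh0.le
  have hxR : ∀ k ≤ N, ‖x k‖ ≤ R + 1 := fun k hk => by
    have h1 := hxd 0 k
    rw [zero_add] at h1
    have h2 := norm_sub_norm_le (x k) (x 0)
    have h3 : ‖x 0‖ ≤ R := hR _ (mem_image_of_mem γ ht)
    have h4 := hkT k hk
    linarith
  have hxF : ∀ k ≤ N, Metric.infDist (x k) F ≤ δ / 2 := fun k hk => by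
    refine (Metric.infDist_le_dist_of_mem hxN).trans ?_
    obtain ⟨m, rfl⟩ := Nat.exists_eq_add_of_le hk
    rw [dist_comm, dist_eq_norm]
    exact (hxd k m).trans (hkT m (by omega))
  have hup : ∀ k m, k + m ≤ N → φ (x (k + m)) ≤ φ (x k) + η * (m * h) := by
    intro k m
    induction m with
    | zero => simp
    | succ m ih =>
      intro hm
      have h1 := hGφ (x (k + m)) (hxR _ (by omega))
      rw [← hxs] at h1
      have h2 := mul_nonneg hh0.le (hφW0 (x (k + m)))
      have h3 := ih (by omega)
      rw [← add_assoc]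
      push_cast
      linarith
  have hx0 : φ (x 0) ≤ c + ε := hγ t ht
  have hηT : ∀ m ≤ N, η * (m * h) ≤ η := fun m hm =>
    mul_le_of_le_one_right hη0.le ((hkT m hm).trans hT1)
  have hxc : ∀ k ≤ N, |φ (x k) - c| ≤ β := fun k hk => by
    have h1 := hup 0 k (by omega)
    rw [zero_add] at h1
    have h2 := hηT k hk
    obtain ⟨m, hm⟩ := Nat.exists_eq_add_of_le hk
    have h3 := hup k m (by omega)
    rw [← hm] at h3
    have h4 := hηT m (by omega)
    have h5 := hc _ hxN
    rw [abs_le]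
    constructor <;> linarith
  have hdec : ∀ k ≤ N, φ (x k) ≤ φ (x 0) - (μ / 2 - η) * (k * h) := by
    intro k
    induction k with
    | zero => simp
    | succ k ih =>
      intro hk
      have h1 := hGφ (x k) (hxR _ (by omega))
      rw [← hxs] at h1
      have h2 := mul_le_mul_of_nonneg_left
        (hφWμ (x k) (hxF k (by omega)) (hxc k (by omega))) hh0.le
      have h3 := ih (by omega)
      push_cast
      linarith
  have h1 := hdec N le_rfl
  rw [hNh] at h1
  have h2 := hc _ hxN
  nlinarith

/-- Theorem 1.3 (Pucci–Serrin mountain pass type theorem, finite dimension). -/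
theorem pucci_serrin_mountain_pass_theorem
    {X : Type*} [NormedAddCommGroup X] [NormedSpace ℝ X] [FiniteDimensional ℝ X]
    (φ : X → ℝ) (hφ : ContDiff ℝ 1 φ)
    (e : X) (a r : ℝ) (hr : 0 < r) (her : r < ‖e‖)
    (h₁ : a ≤ sInf (φ '' {u : X | ‖u‖ = r}))
    (h₂ : φ 0 ≤ a) (h₃ : φ e ≤ a)
    (h₄ : ∀ (u : ℕ → X) (L : ℝ), a ≤ L →
      Filter.Tendsto (fun k => φ (u k)) Filter.atTop (nhds L) →
      Filter.Tendsto (fun k => fderiv ℝ φ (u k)) Filter.atTop (nhds 0) →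
      ∃ (v : X) (σ : ℕ → ℕ), StrictMono σ ∧
        Filter.Tendsto (fun k => u (σ k)) Filter.atTop (nhds v))
    (c : ℝ)
    (hc : c = sInf {m : ℝ | ∃ γ : ℝ → X, ContinuousOn γ (Set.Icc 0 1) ∧
      γ 0 = 0 ∧ γ 1 = e ∧ m = sSup ((fun t => φ (γ t)) '' Set.Icc (0 : ℝ) 1)}) :
    ∃ u : X, φ u = c ∧ fderiv ℝ φ u = 0 := by
  have : ProperSpace X := FiniteDimensional.proper ℝ X
  have hφc : Continuous φ := hφ.continuous
  have hsphere : ∀ u : X, ‖u‖ = r → a ≤ φ u := fun u hu => by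
    refine h₁.trans (csInf_le ?_ (mem_image_of_mem φ hu))
    have hS : {u : X | ‖u‖ = r} = Metric.sphere 0 r := by ext; simp
    rw [hS]
    exact ((isCompact_sphere (0 : X) r).image hφc).bddBelow
  have hcross : ∀ γ : ℝ → X, ContinuousOn γ (Icc 0 1) → γ 0 = 0 → γ 1 = e →
      ∃ t ∈ Icc (0 : ℝ) 1, ‖γ t‖ = r := fun γ hγ h0 h1 =>
    intermediate_value_Icc zero_le_one hγ.norm
      ⟨by simpa [h0] using hr.le, by simpa [h1] using her.le⟩
  have hcomp : ∀ γ : ℝ → X, ContinuousOn γ (Icc 0 1) →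
      IsCompact ((fun t => φ (γ t)) '' Icc (0 : ℝ) 1) := fun γ hγ =>
    isCompact_Icc.image_of_continuousOn (hφc.comp_continuousOn hγ)
  set M : Set ℝ := {m : ℝ | ∃ γ : ℝ → X, ContinuousOn γ (Set.Icc 0 1) ∧
      γ 0 = 0 ∧ γ 1 = e ∧ m = sSup ((fun t => φ (γ t)) '' Set.Icc (0 : ℝ) 1)} with hM
  have hMne : M.Nonempty :=
    ⟨_, fun t => t • e, by fun_prop, by simp, by simp, rfl⟩
  have hMa : ∀ m ∈ M, a ≤ m := by
    rintro m ⟨γ, hγ, h0, h1, rfl⟩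
    obtain ⟨t, ht, htr⟩ := hcross γ hγ h0 h1
    exact (hsphere _ htr).trans (le_csSup (hcomp γ hγ).bddAbove ⟨t, ht, rfl⟩)
  have hac : a ≤ c := hc ▸ le_csInf hMne hMa
  have hlow : ∀ ε > 0, ∃ γ : ℝ → X, ContinuousOn γ (Icc 0 1) ∧ γ 0 = 0 ∧ γ 1 = e ∧
      ∀ t ∈ Icc (0 : ℝ) 1, φ (γ t) ≤ c + ε := by
    intro ε hε
    obtain ⟨m, ⟨γ, hγ, h0, h1, rfl⟩, hm⟩ :=
      exists_lt_of_csInf_lt hMne (show sInf M < c + ε by rw [← hc]; linarith)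
    exact ⟨γ, hγ, h0, h1, fun t ht =>
      (le_csSup (hcomp γ hγ).bddAbove ⟨t, ht, rfl⟩).trans hm.le⟩
  have hps : ∀ β > 0, ∃ x, |φ x - c| ≤ β ∧ ‖fderiv ℝ φ x‖ ≤ β := by
    intro β hβ
    rcases hac.eq_or_lt with rfl | hlt
    · exact exists_almost_critical_of_linking hφ (F := {u : X | ‖u‖ = r})
        (isClosed_eq continuous_norm continuous_const) (by simpa using hr.ne)
        (by simpa using her.ne') hsphere hcross hlow hβ
    · refine exists_almost_critical_of_linking hφ (F := {u : X | c ≤ φ u})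
        (isClosed_le continuous_const hφc) (by simpa using h₂.trans_lt hlt)
        (by simpa using h₃.trans_lt hlt) (fun _ h => h) (fun γ hγ h0 h1 => ?_) hlow hβ
      obtain ⟨t, ht, htm⟩ := (hcomp γ hγ).sSup_mem
        ((nonempty_Icc.2 zero_le_one).image _)
      have hcm : c ≤ sSup ((fun t => φ (γ t)) '' Icc (0 : ℝ) 1) := by
        rw [hc]
        exact csInf_le ⟨a, hMa⟩ ⟨γ, hγ, h0, h1, rfl⟩
      exact ⟨t, ht, hcm.trans_eq htm.symm⟩
  choose u hu hu' using fun n : ℕ => hps (1 / ((n : ℝ) + 1)) Nat.one_div_pos_of_nat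
  have hlim := tendsto_one_div_add_atTop_nhds_zero_nat (𝕜 := ℝ)
  have hφu : Tendsto (fun k => φ (u k)) atTop (𝓝 c) :=
    tendsto_iff_norm_sub_tendsto_zero.2 (squeeze_zero (fun _ => norm_nonneg _) hu hlim)
  have hdu : Tendsto (fun k => fderiv ℝ φ (u k)) atTop (𝓝 0) :=
    squeeze_zero_norm hu' hlim
  obtain ⟨v, σ, hσ, hv⟩ := h₄ u c hac hφu hdu
  exact ⟨v, tendsto_nhds_unique ((hφc.tendsto v).comp hv) (hφu.comp hσ.tendsto_atTop),
    tendsto_nhds_unique (((hφ.continuous_fderiv one_ne_zero).tendsto v).comp hv)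
      (hdu.comp hσ.tendsto_atTop)⟩
end

section
/- Let M ≥ 6 be a positive integer, let F : ℤ × ℝ → ℝ be continuous in x, M-periodic in n, nonnegative, and satisfy condition (A₃) with constants w₁, w₂ > 0 and w₃ (w₃ > 2 if M even, w₃ > 1 + cos(π/M) if M odd). Fix an index n ∈ {1, …, M} and define on E_M the functional φ(u) = (1/2)∑_{s=1}^{M}(Δu_s)² − F(n, u_n) − w₃(∑_{s=1}^{n−1} u_s² + ∑_{s=n+1}^{M} u_s²). Then, with w′ := w + w₂ where w := max{|F(m, x) − w₃x² + w₂| : m ∈ ℤ, |x| ≤ w₁}, and λ_max := 4 if M even, 2(1 + cos(π/M)) if M odd, one has φ(u) ≤ (λ_max/2 − w₃)‖u‖² + w′ ≤ w′ for all u ∈ E_M; in particular φ is bounded from above on E_M. -/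
open Finset in
theorem sum_Icc_one_int (f : ℤ → ℝ) (M : ℕ) :
    ∑ s ∈ Icc (1 : ℤ) M, f s = ∑ k ∈ range M, f (k + 1) := by
  refine sum_nbij' (fun s => (s - 1).toNat) (fun k => (k : ℤ) + 1) ?_ ?_ ?_ ?_ ?_
  · intro s hs; simp only [mem_Icc, mem_range] at *; omega
  · intro k hk; simp only [mem_Icc, mem_range] at *; omega
  · intro s hs; simp only [mem_Icc] at *; omega
  · intro k hk; simp
  · intro s hs
    simp only [mem_Icc] at hs
    congr 1; omega

open Finset in
theorem sum_Icc_one_int_split (f : ℤ → ℝ) {n N : ℤ} (h₁ : 1 ≤ n) (h₂ : n ≤ N) :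
    ∑ s ∈ Icc (1 : ℤ) N, f s =
      f n + (∑ s ∈ Icc (1 : ℤ) (n - 1), f s + ∑ s ∈ Icc (n + 1) N, f s) := by
  have hd : Disjoint (Icc (1 : ℤ) (n - 1)) (Icc (n + 1) N) := by
    rw [disjoint_left]; intro s; simp only [mem_Icc]; omega
  have hn : n ∉ Icc (1 : ℤ) (n - 1) ∪ Icc (n + 1) N := by
    simp only [mem_union, mem_Icc]; omega
  rw [← sum_union hd, ← sum_insert hn]
  congr 1
  ext s; simp only [mem_insert, mem_union, mem_Icc]; omega

/-- A discrete harmonic-oscillator action with fixed endpoints is bounded below by its value at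
the critical path. -/
theorem sin_mul_sum_ge (v : ℕ → ℝ) (θ : ℝ) (hθ : 0 < θ) (k : ℕ)
    (hk : (k + 1) * θ < Real.pi) :
    Real.sin θ * (Real.cos ((k + 1) * θ) * (v 0 ^ 2 + v (k + 1) ^ 2) - 2 * v 0 * v (k + 1)) ≤
      Real.sin ((k + 1) * θ) * ∑ j ∈ Finset.range (k + 1),
        (Real.cos θ * (v j ^ 2 + v (j + 1) ^ 2) - 2 * v j * v (j + 1)) := by
  induction k with
  | zero => simp
  | succ k ih =>
    push_cast at hk ⊢
    have ih := ih (by linarith)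
    have hs : 0 < Real.sin ((k + 1) * θ) :=
      Real.sin_pos_of_pos_of_lt_pi (by positivity) (by linarith)
    have hs' : 0 < Real.sin ((k + 1 + 1) * θ) :=
      Real.sin_pos_of_pos_of_lt_pi (by positivity) hk
    have e : ((k : ℝ) + 1 + 1) * θ = (k + 1) * θ + θ := by ring
    rw [Finset.sum_range_succ]
    generalize ∑ j ∈ Finset.range (k + 1),
        (Real.cos θ * (v j ^ 2 + v (j + 1) ^ 2) - 2 * v j * v (j + 1)) = S at *
    have hsin := Real.sin_add ((k + 1) * θ) θ
    have hcos := Real.cos_add ((k + 1) * θ) θ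
    rw [← e] at hsin hcos
    have h₁ := Real.sin_sq_add_cos_sq ((k + 1) * θ)
    have h₂ := Real.sin_sq_add_cos_sq θ
    generalize Real.sin ((k + 1 + 1) * θ) = s' at *
    generalize Real.cos ((k + 1 + 1) * θ) = q' at *
    generalize Real.sin ((k + 1) * θ) = s at *
    generalize Real.cos ((k + 1) * θ) = q at *
    generalize Real.sin θ = σ at *
    generalize Real.cos θ = c at *
    generalize v 0 = x at *
    generalize v (k + 1) = y at *
    generalize v (k + 1 + 1) = z at *
    refine le_of_mul_le_mul_left ?_ hs
    have key : s' * (σ * (q * (x ^ 2 + y ^ 2) - 2 * x * y))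
        + s * (s' * (c * (y ^ 2 + z ^ 2) - 2 * y * z))
        - s * (σ * (q' * (x ^ 2 + z ^ 2) - 2 * x * z)) = (s' * y - σ * x - s * z) ^ 2 := by
      subst hsin hcos
      linear_combination σ ^ 2 * x ^ 2 * h₁ + s ^ 2 * z ^ 2 * h₂
    nlinarith [mul_le_mul_of_nonneg_left ih hs'.le, sq_nonneg (s' * y - σ * x - s * z)]

/-- The sharp discrete Wirtinger-type inequality for antiperiodic sequences. -/
theorem sum_antiperiodic_nonneg (v : ℕ → ℝ) (M : ℕ) (hM : 2 ≤ M) (hv : v M = -v 0) :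
    0 ≤ ∑ j ∈ Finset.range M,
      (Real.cos (Real.pi / M) * (v j ^ 2 + v (j + 1) ^ 2) - 2 * v j * v (j + 1)) := by
  obtain ⟨k, rfl⟩ := Nat.exists_eq_add_of_le' hM
  have hpos : (0 : ℝ) < ((k + 2 : ℕ) : ℝ) := by positivity
  set θ := Real.pi / ((k + 2 : ℕ) : ℝ) with hθ
  have hθ0 : 0 < θ := div_pos Real.pi_pos hpos
  have e : ((k : ℝ) + 1) * θ = Real.pi - θ := by
    rw [hθ]; field_simp; push_cast; ring
  have h := sin_mul_sum_ge v θ hθ0 k (by linarith)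
  have hk0 : 0 ≤ (k : ℝ) * θ := by positivity
  have hsin : 0 < Real.sin θ := Real.sin_pos_of_pos_of_lt_pi hθ0 (by nlinarith)
  rw [e, Real.sin_pi_sub, Real.cos_pi_sub] at h
  have h := le_of_mul_le_mul_left h hsin
  rw [Finset.sum_range_succ, show k + 1 + 1 = k + 2 from rfl, hv]
  linarith

theorem sum_shift_of_periodic (u : ℤ → ℝ) (M : ℕ) (hu : ∀ s, u (s + M) = u s) (g : ℝ → ℝ) :
    ∑ k ∈ Finset.range M, g (u (k + 1 + 1)) = ∑ k ∈ Finset.range M, g (u (k + 1)) := by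
  have h := (Finset.sum_range_succ (fun k : ℕ => g (u (k + 1))) M).symm.trans
    (Finset.sum_range_succ' (fun k : ℕ => g (u (k + 1))) M)
  have hM : u (M + 1) = u 1 := by rw [add_comm]; exact hu 1
  simp only [hM, Nat.cast_add, Nat.cast_one, Nat.cast_zero, zero_add] at h
  linarith

theorem sum_sq_diff_le (u : ℤ → ℝ) (M : ℕ) (hM : 2 ≤ M) (hu : ∀ s, u (s + M) = u s) :
    ∑ s ∈ Finset.Icc (1 : ℤ) M, (u (s + 1) - u s) ^ 2 ≤
      (if Even M then 4 else 2 * (1 + Real.cos (Real.pi / M))) *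
        ∑ s ∈ Finset.Icc (1 : ℤ) M, u s ^ 2 := by
  rw [sum_Icc_one_int (fun s => (u (s + 1) - u s) ^ 2), sum_Icc_one_int (fun s => u s ^ 2)]
  have hshift := sum_shift_of_periodic u M hu (fun x => x ^ 2)
  split_ifs with hev
  · have : ∑ k ∈ Finset.range M, (u (k + 1 + 1) - u (k + 1)) ^ 2 ≤
        ∑ k ∈ Finset.range M, (2 * u (k + 1 + 1) ^ 2 + 2 * u (k + 1) ^ 2) :=
      Finset.sum_le_sum fun k _ => by nlinarith [sq_nonneg (u (k + 1 + 1) + u (k + 1))]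
    rw [Finset.sum_add_distrib, ← Finset.mul_sum, ← Finset.mul_sum] at this
    linarith
  · have hodd : Odd M := Nat.not_even_iff_odd.mp hev
    have h := sum_antiperiodic_nonneg (fun k => (-1) ^ k * u (k + 1)) M hM (by
      have h1 : u (M + 1) = u 1 := by rw [add_comm]; exact hu 1
      simp [hodd.neg_one_pow, h1])
    have key : ∀ k : ℕ, Real.cos (Real.pi / M) * (((-1) ^ k * u (k + 1)) ^ 2 +
          ((-1) ^ (k + 1) * u ((k + 1 : ℕ) + 1)) ^ 2) -
          2 * ((-1) ^ k * u (k + 1)) * ((-1) ^ (k + 1) * u ((k + 1 : ℕ) + 1)) =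
        (1 + Real.cos (Real.pi / M)) * u (k + 1 + 1) ^ 2 +
          (1 + Real.cos (Real.pi / M)) * u (k + 1) ^ 2 - (u (k + 1 + 1) - u (k + 1)) ^ 2 := by
      intro k
      have h2 : ((-1 : ℝ) ^ k) ^ 2 = 1 := by rw [← pow_mul, mul_comm, pow_mul]; simp
      push_cast
      rw [pow_succ]
      linear_combination (Real.cos (Real.pi / M) * (u (k + 1) ^ 2 + u (k + 1 + 1) ^ 2) +
        2 * u (k + 1) * u (k + 1 + 1)) * h2
    simp only [key, Finset.sum_sub_distrib, Finset.sum_add_distrib, ← Finset.mul_sum] at h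
    rw [hshift] at h
    linarith

/-- A family of continuous functions that is periodic in its index is uniformly bounded on
compact sets. -/
theorem bddAbove_of_periodic_family (G : ℤ → ℝ → ℝ) (M : ℕ) (hM : 0 < M)
    (hcont : ∀ m, Continuous (G m)) (hper : ∀ (m : ℤ) (x : ℝ), G (m + M) x = G m x) (r : ℝ) :
    BddAbove {y : ℝ | ∃ (m : ℤ) (x : ℝ), |x| ≤ r ∧ y = G m x} := by
  have hb : BddAbove (⋃ m ∈ Set.Ico (0 : ℤ) M, G m '' Set.Icc (-r) r) :=
    (Set.finite_Ico (0 : ℤ) M).bddAbove_biUnion.mpr fun m _ =>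
      (isCompact_Icc.image (hcont m)).bddAbove
  refine hb.mono ?_
  rintro y ⟨m, x, hx, rfl⟩
  have hP : Function.Periodic G (M : ℤ) := fun m => funext (hper m)
  have hmod : G (m % M) = G m := by
    have h := hP.sub_zsmul_eq (x := m) (m / M)
    rwa [smul_eq_mul, mul_comm, ← Int.emod_def] at h
  have hM' : (0 : ℤ) < M := by exact_mod_cast hM
  simp only [Set.mem_iUnion]
  exact ⟨m % M, ⟨Int.emod_nonneg _ hM'.ne', Int.emod_lt_of_pos _ hM'⟩, x, abs_le.mp hx,
    by rw [hmod]⟩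

/-- Step 2 of the proof of Theorem 1.6: the functional `φ` is bounded from above
on `E_M`, with the explicit bound `φ(u) ≤ (λ_max/2 − w₃)‖u‖² + w′ ≤ w′`. -/
theorem functional_bounded_above
    (M : ℕ) (hM : 6 ≤ M) (F : ℤ → ℝ → ℝ)
    (hcont : ∀ m : ℤ, Continuous (F m))
    (hper : ∀ (m : ℤ) (x : ℝ), F (m + M) x = F m x)
    (hFpos : ∀ (m : ℤ) (x : ℝ), 0 ≤ F m x)
    (w₁ w₂ w₃ : ℝ) (hw₁ : 0 < w₁) (hw₂ : 0 < w₂)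
    (hw₃even : Even M → 2 < w₃)
    (hw₃odd : Odd M → 1 + Real.cos (Real.pi / M) < w₃)
    (hA3 : ∀ (m : ℤ) (x : ℝ), w₁ ≤ |x| → w₃ * x ^ 2 - w₂ ≤ F m x)
    (n : ℤ) (hn₁ : 1 ≤ n) (hn₂ : n ≤ M)
    (w w' lmax : ℝ)
    (hw : w = sSup {y : ℝ | ∃ (m : ℤ) (x : ℝ), |x| ≤ w₁ ∧ y = |F m x - w₃ * x ^ 2 + w₂|})
    (hw' : w' = w + w₂)
    (hl : lmax = if Even M then 4 else 2 * (1 + Real.cos (Real.pi / M))) :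
    ∀ u : ℤ → ℝ, (∀ s : ℤ, u (s + M) = u s) →
      (1 / 2 * ∑ s ∈ Finset.Icc (1 : ℤ) (M : ℤ), (u (s + 1) - u s) ^ 2
          - F n (u n)
          - w₃ * (∑ s ∈ Finset.Icc (1 : ℤ) (n - 1), (u s) ^ 2 +
                  ∑ s ∈ Finset.Icc (n + 1) (M : ℤ), (u s) ^ 2) ≤
        (lmax / 2 - w₃) * ∑ s ∈ Finset.Icc (1 : ℤ) (M : ℤ), (u s) ^ 2 + w') ∧
      (lmax / 2 - w₃) * ∑ s ∈ Finset.Icc (1 : ℤ) (M : ℤ), (u s) ^ 2 + w' ≤ w' := by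
  intro u hu
  have hlw : lmax / 2 - w₃ ≤ 0 := by
    rw [hl]
    split_ifs with hev
    · linarith [hw₃even hev]
    · linarith [hw₃odd (Nat.not_even_iff_odd.mp hev)]
  have hsum : 0 ≤ ∑ s ∈ Finset.Icc (1 : ℤ) (M : ℤ), (u s) ^ 2 :=
    Finset.sum_nonneg fun s _ => sq_nonneg _
  refine ⟨?_, by nlinarith⟩
  have hbdd := bddAbove_of_periodic_family (fun m x => |F m x - w₃ * x ^ 2 + w₂|) M (by omega)
    (fun m => by have := hcont m; fun_prop) (fun m x => by simp only [hper]) w₁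
  have hle : ∀ (m : ℤ) (x : ℝ), |x| ≤ w₁ → |F m x - w₃ * x ^ 2 + w₂| ≤ w := fun m x hx => by
    rw [hw]; exact le_csSup hbdd ⟨m, x, hx, rfl⟩
  have hw0 : 0 ≤ w := (abs_nonneg _).trans (hle 0 0 (by simpa using hw₁.le))
  have hF : w₃ * u n ^ 2 - w' ≤ F n (u n) := by
    rcases le_total |u n| w₁ with h | h
    · linarith [(abs_le.mp (hle n (u n) h)).1]
    · linarith [hA3 n (u n) h]
  have hd := sum_sq_diff_le u M (by omega) hu
  rw [← hl] at hd
  have hsplit := sum_Icc_one_int_split (fun s => u s ^ 2) hn₁ hn₂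
  have hsplit' := congrArg (w₃ * ·) hsplit
  simp only [mul_add] at hsplit' ⊢
  linarith
end
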